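/- Let V be a ℚ-vector space, Σ ⊆ V finite, and f : V → ℚ linear with f(μ) > 0 for all μ ∈ Σ. Assume no α ∈ Σ is a nonnegative rational combination of Σ ∖ {α}. Let Ψ⁺ be a subset of the set of nonzero ℤ₊-linear combinations of Σ with Σ ⊆ Ψ⁺. Define, for γ, β ∈ Ψ⁺, γ ⪯ β iff β = a·γ + Σ_{τ ∈ Ψ⁺∖{γ,β}} a_τ·τ for some rational a > 0 and a_τ ≥ 0, and set Π(Ψ) = {β ∈ Ψ⁺ : for all γ ∈ Ψ⁺, γ ⪯ β implies γ ∈ ℕβ}. Then Σ = Π(Ψ). -/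

import Mathlib

theorem stmt_11 {V : Type*} [AddCommGroup V] [Module ℚ V] [DecidableEq V]
    (Sig : Finset V) (f : V →ₗ[ℚ] ℚ) (hf : ∀ μ ∈ Sig, 0 < f μ)
    (hpi : ∀ α ∈ Sig, ¬ ∃ c : V → ℚ, (∀ μ ∈ Sig.erase α, 0 ≤ c μ) ∧
      α = ∑ μ ∈ Sig.erase α, c μ • μ)
    (Ψplus : Set V)
    (hΨ : Ψplus ⊆ {v : V | v ≠ 0 ∧ ∃ c : V → ℕ, v = ∑ μ ∈ Sig, (c μ : ℚ) • μ})
    (hSigPsi : ↑Sig ⊆ Ψplus)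
    (le : V → V → Prop)
    (hle : ∀ γ β, le γ β ↔ (γ ∈ Ψplus ∧ β ∈ Ψplus ∧
      ∃ (a : ℚ) (T : Finset V) (c : V → ℚ), 0 < a ∧ (↑T ⊆ Ψplus \ {γ, β}) ∧
        (∀ τ ∈ T, 0 ≤ c τ) ∧ β = a • γ + ∑ τ ∈ T, c τ • τ)) :
    ↑Sig = {β ∈ Ψplus | ∀ γ ∈ Ψplus, le γ β → ∃ n : ℕ, γ = (n : ℚ) • β} := by
  have hg : ∀ v : V, ∃ c : V → ℕ, v ∈ Ψplus → v = ∑ μ ∈ Sig, (c μ : ℚ) • μ := by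
    intro v
    by_cases h : v ∈ Ψplus
    · obtain ⟨_, c, hc⟩ := hΨ h
      exact ⟨c, fun _ => hc⟩
    · exact ⟨0, fun h' => absurd h' h⟩
  choose g hg using hg
  ext β
  simp only [Set.mem_setOf_eq, Finset.mem_coe]
  constructor
  · intro hβ
    refine ⟨hSigPsi hβ, ?_⟩
    intro γ hγ hl
    obtain ⟨-, -, a, T, c, ha, hT, hc, heq⟩ := (hle γ β).1 hl
    obtain ⟨d, hd⟩ : ∃ d : V → ℚ, d = fun μ => a * g γ μ + ∑ τ ∈ T, c τ * g τ μ := ⟨_, rfl⟩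
    have hge : ∀ μ, a * g γ μ ≤ d μ := by
      intro μ
      rw [hd]
      have : 0 ≤ ∑ τ ∈ T, c τ * (g τ μ : ℚ) :=
        Finset.sum_nonneg fun τ hτ => mul_nonneg (hc τ hτ) (Nat.cast_nonneg _)
      simpa using this
    have hd0 : ∀ μ, 0 ≤ d μ := fun μ =>
      le_trans (mul_nonneg ha.le (Nat.cast_nonneg _)) (hge μ)
    have hsum : β = ∑ μ ∈ Sig, d μ • μ := by
      have h1 : ∑ τ ∈ T, c τ • τ = ∑ τ ∈ T, c τ • ∑ μ ∈ Sig, (g τ μ : ℚ) • μ :=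
        Finset.sum_congr rfl fun τ hτ => by
          rw [← hg τ (hT hτ).1]
      have h2 : a • γ = a • ∑ μ ∈ Sig, (g γ μ : ℚ) • μ := by rw [← hg γ hγ]
      rw [h1, h2] at heq
      rw [heq, hd]
      simp only [add_smul, Finset.sum_add_distrib, Finset.smul_sum, Finset.sum_smul, mul_smul]
      congr 1
      exact Finset.sum_comm
    rw [← Finset.add_sum_erase _ _ hβ] at hsum
    have hs2 : (1 - d β) • β = ∑ μ ∈ Sig.erase β, d μ • μ := by
      rw [sub_smul, one_smul, sub_eq_iff_eq_add, add_comm]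
      exact hsum
    rcases lt_or_ge (d β) 1 with h | h
    · exfalso
      have hp : 0 < 1 - d β := by linarith
      refine hpi β hβ ⟨fun μ => (1 - d β)⁻¹ * d μ,
        fun μ _ => mul_nonneg (inv_nonneg.2 hp.le) (hd0 μ), ?_⟩
      simp only [mul_smul]
      rw [← Finset.smul_sum, ← hs2, smul_smul, inv_mul_cancel₀ hp.ne', one_smul]
    · have hfs : (1 - d β) * f β = ∑ μ ∈ Sig.erase β, d μ * f μ := by
        have := congrArg f hs2
        simpa using this
      have hnn : ∀ μ ∈ Sig.erase β, 0 ≤ d μ * f μ := fun μ hμ =>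
        mul_nonneg (hd0 μ) (hf μ (Finset.mem_of_mem_erase hμ)).le
      have hz : ∑ μ ∈ Sig.erase β, d μ * f μ = 0 := by
        apply le_antisymm _ (Finset.sum_nonneg hnn)
        rw [← hfs]
        exact mul_nonpos_of_nonpos_of_nonneg (by linarith) (hf β hβ).le
      rw [Finset.sum_eq_zero_iff_of_nonneg hnn] at hz
      refine ⟨g γ β, ?_⟩
      have hγe := hg γ hγ
      rw [← Finset.add_sum_erase _ _ hβ, Finset.sum_eq_zero, add_zero] at hγe
      · exact hγe
      · intro μ hμ
        have hdz : d μ = 0 := by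
          rcases mul_eq_zero.1 (hz μ hμ) with h | h
          · exact h
          · exact absurd h (hf μ (Finset.mem_of_mem_erase hμ)).ne'
        have h3 : a * (g γ μ : ℚ) ≤ 0 := hdz ▸ hge μ
        have h4 : (g γ μ : ℚ) ≤ 0 := by
          by_contra hcon
          push Not at hcon
          have := mul_pos ha hcon
          linarith
        rw [le_antisymm h4 (Nat.cast_nonneg _), zero_smul]
  · rintro ⟨hβ, hmin⟩
    by_contra hn
    have he := hg β hβ
    obtain ⟨μ, hμ, hpos⟩ : ∃ μ ∈ Sig, g β μ ≠ 0 := by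
      by_contra hcon
      push Not at hcon
      apply (hΨ hβ).1
      rw [he]
      exact Finset.sum_eq_zero fun μ hμ => by simp [hcon μ hμ]
    have hl : le μ β := by
      refine (hle μ β).2 ⟨hSigPsi hμ, hβ, (g β μ : ℚ), Sig.erase μ, fun τ => (g β τ : ℚ),
        by exact_mod_cast Nat.pos_of_ne_zero hpos, ?_, fun τ _ => Nat.cast_nonneg _, ?_⟩
      · intro τ hτ
        have hτ' := Finset.mem_erase.1 (Finset.mem_coe.1 hτ)
        refine ⟨hSigPsi hτ'.2, ?_⟩
        rintro (h | h)
        · exact hτ'.1 h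
        · exact hn (h ▸ hτ'.2)
      · rw [Finset.add_sum_erase Sig (fun τ => (g β τ : ℚ) • τ) hμ]
        exact he
    obtain ⟨n, hnn⟩ := hmin μ (hSigPsi hμ) hl
    have hfμ := hf μ hμ
    have h1 : f μ = n * f β := by
      have := congrArg f hnn
      simpa using this
    have h2 : f μ ≤ f β := by
      have h3 : f β = ∑ τ ∈ Sig, (g β τ : ℚ) * f τ := by
        have := congrArg f he
        simpa using this
      have h4 : (g β μ : ℚ) * f μ ≤ ∑ τ ∈ Sig, (g β τ : ℚ) * f τ :=
        Finset.single_le_sum (f := fun τ => (g β τ : ℚ) * f τ)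
          (fun τ hτ => mul_nonneg (Nat.cast_nonneg _) (hf τ hτ).le) hμ
      have h5 : (1 : ℚ) ≤ g β μ := by exact_mod_cast Nat.pos_of_ne_zero hpos
      nlinarith
    have hn1 : n = 1 := by
      rcases Nat.lt_trichotomy n 1 with h | h | h
      · have : n = 0 := by omega
        subst this
        simp at h1
        linarith
      · exact h
      · have : (2 : ℚ) ≤ n := by exact_mod_cast h
        nlinarith
    subst hn1
    apply hn
    have : μ = β := by simpa using hnn
    exact this ▸ hμ
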